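/- Let ≺ be a normal local Newton ordering for (L, δ), I ⊆ K[x₁,…,xₙ] an ideal with Ī = (I K[x]_{(x)}) ∩ K[x], and suppose each graded piece of K[x]/Ī with respect to the Newton filtration is finite-dimensional. Then for each s ∈ ℝ, dim_K (K[x]/Ī)_s / (K[x]/Ī)_{>s} = |{ x^α | x^α ∉ L(I), w_δ(α) = s }|. -/

import Mathlib

open MvPolynomial

/-- The lead monomial (exponent vector) of a polynomial with respect to a total
order `ord` on monomials; junk value `0` for the zero polynomial. -/
noncomputable def leadMonomial {n : ℕ} {K : Type} [CommRing K]
    (ord : LinearOrder (Fin n →₀ ℕ)) (f : MvPolynomial (Fin n) K) : Fin n →₀ ℕ :=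
  letI := ord
  if h : f.support.Nonempty then f.support.max' h else 0

/-- The lead monomial set `L(I) = { LM(g) | 0 ≠ g ∈ I }` of an ideal. -/
noncomputable def leadSetI {n : ℕ} {K : Type} [CommRing K]
    (ord : LinearOrder (Fin n →₀ ℕ)) (I : Ideal (MvPolynomial (Fin n) K)) :
    Set (Fin n →₀ ℕ) :=
  {μ | ∃ g ∈ I, g ≠ 0 ∧ μ = leadMonomial ord g}

/-- The Newton weight `w_δ(α) = min_{l ∈ L} l(α + δ)` of an exponent vector. -/
noncomputable def newtonWeight {n : ℕ}
    (L : Finset ((Fin n → ℝ) →ₗ[ℝ] ℝ)) (hL : L.Nonempty)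
    (δ : Fin n → ℝ) (μ : Fin n →₀ ℕ) : ℝ :=
  L.inf' hL fun l => l ((fun i => (μ i : ℝ)) + δ)

/-- The filtration piece `(K[x]/Ī)_s`: the image in `K[x]/Ī` of the `K`-subspace of
polynomials all of whose monomials have Newton weight `≥ s`. -/
noncomputable def filtPiece {n : ℕ} {K : Type} [Field K]
    (L : Finset ((Fin n → ℝ) →ₗ[ℝ] ℝ)) (hL : L.Nonempty) (δ : Fin n → ℝ)
    (Ibar : Ideal (MvPolynomial (Fin n) K)) (s : ℝ) :
    Submodule K (MvPolynomial (Fin n) K ⧸ Ibar) :=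
  Submodule.map (Ideal.Quotient.mkₐ K Ibar).toLinearMap
    (Submodule.span K
      {f : MvPolynomial (Fin n) K | ∀ μ ∈ f.support, s ≤ newtonWeight L hL δ μ})

/-- The filtration piece `(K[x]/Ī)_{>s}`. -/
noncomputable def filtPieceGT {n : ℕ} {K : Type} [Field K]
    (L : Finset ((Fin n → ℝ) →ₗ[ℝ] ℝ)) (hL : L.Nonempty) (δ : Fin n → ℝ)
    (Ibar : Ideal (MvPolynomial (Fin n) K)) (s : ℝ) :
    Submodule K (MvPolynomial (Fin n) K ⧸ Ibar) :=
  Submodule.map (Ideal.Quotient.mkₐ K Ibar).toLinearMap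
    (Submodule.span K
      {f : MvPolynomial (Fin n) K | ∀ μ ∈ f.support, s < newtonWeight L hL δ μ})

section LeadMonomial

variable {n : ℕ} {K : Type} [CommRing K] (ord : LinearOrder (Fin n →₀ ℕ))

theorem leadMonomial_mem_support {f : MvPolynomial (Fin n) K} (hf : f ≠ 0) :
    leadMonomial ord f ∈ f.support := by
  have h : f.support.Nonempty := support_nonempty.mpr hf
  rw [leadMonomial, dif_pos h]
  exact @Finset.max'_mem _ ord _ h

theorem le_leadMonomial {f : MvPolynomial (Fin n) K} {μ : Fin n →₀ ℕ} (hμ : μ ∈ f.support) :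
    ord.le μ (leadMonomial ord f) := by
  have h : f.support.Nonempty := ⟨μ, hμ⟩
  rw [leadMonomial, dif_pos h]
  exact @Finset.le_max' _ ord _ μ hμ

theorem leadMonomial_eq_of_forall_le {f : MvPolynomial (Fin n) K} {μ : Fin n →₀ ℕ}
    (hμ : μ ∈ f.support) (h : ∀ ν ∈ f.support, ord.le ν μ) : leadMonomial ord f = μ :=
  ord.le_antisymm _ _ (h _ (leadMonomial_mem_support ord (support_nonempty.mp ⟨μ, hμ⟩)))
    (le_leadMonomial ord hμ)

end LeadMonomial

section UnitMul

variable {n : ℕ} {K : Type} [Field K] (ord : LinearOrder (Fin n →₀ ℕ))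

/-- Multiplication by a polynomial with lead monomial `1` preserves lead monomials. -/
theorem leadMonomial_unit_mul
    (hnormal : ∀ (f : MvPolynomial (Fin n) K), f ≠ 0 → ∀ α : Fin n →₀ ℕ,
      ord.lt α 0 → ord.lt (leadMonomial ord (monomial α (1 : K) * f)) (leadMonomial ord f))
    {u f : MvPolynomial (Fin n) K} (hu : u ≠ 0) (hu0 : leadMonomial ord u = 0) (hf : f ≠ 0) :
    leadMonomial ord (u * f) = leadMonomial ord f := by
  have hexp (ν : Fin n →₀ ℕ) :
      coeff ν (u * f) = ∑ α ∈ u.support, coeff α u * coeff ν (monomial α (1 : K) * f) := by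
    conv_lhs => rw [u.as_sum, Finset.sum_mul, coeff_sum]
    refine Finset.sum_congr rfl fun α _ ↦ ?_
    rw [← coeff_C_mul, ← mul_assoc, C_mul_monomial, mul_one]
  have hzero {α ν : Fin n →₀ ℕ} (hα : α ∈ u.support) (hα0 : α ≠ 0)
      (hν : ord.le (leadMonomial ord f) ν) : coeff ν (monomial α (1 : K) * f) = 0 := by
    by_contra hne
    have hle : ord.le α 0 := hu0 ▸ le_leadMonomial ord hα
    have hlt : ord.lt α 0 := @lt_of_le_of_ne _ ord.toPartialOrder _ _ hle hα0
    have h1 := hnormal f hf α hlt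
    have h2 := le_leadMonomial ord (mem_support_iff.mpr hne)
    exact @not_le_of_gt _ ord.toPreorder _ _ h1 (ord.le_trans _ _ _ hν h2)
  have h0 : (0 : Fin n →₀ ℕ) ∈ u.support := by
    simpa only [hu0] using leadMonomial_mem_support ord hu
  have hcoeff {ν : Fin n →₀ ℕ} (hν : ord.le (leadMonomial ord f) ν) :
      coeff ν (u * f) = coeff 0 u * coeff ν f := by
    rw [hexp, Finset.sum_eq_single_of_mem 0 h0
      fun α hα hα0 ↦ by rw [hzero hα hα0 hν, mul_zero]]
    rw [show (monomial 0 (1 : K) : MvPolynomial (Fin n) K) = 1 from rfl, one_mul]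
  apply leadMonomial_eq_of_forall_le
  · rw [mem_support_iff, hcoeff (ord.le_refl _)]
    exact mul_ne_zero (mem_support_iff.mp h0)
      (mem_support_iff.mp (leadMonomial_mem_support ord hf))
  · intro ν hν
    rcases ord.le_total ν (leadMonomial ord f) with h | h
    · exact h
    · rw [mem_support_iff, hcoeff h] at hν
      exact le_leadMonomial ord (mem_support_iff.mpr (right_ne_zero_of_mul hν))

end UnitMul

theorem finite_setOf_newtonWeight_eq {n : ℕ} (L : Finset ((Fin n → ℝ) →ₗ[ℝ] ℝ))
    (hL : L.Nonempty) (hpos : ∀ l ∈ L, ∀ i : Fin n, 0 < l (Pi.single i 1))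
    (δ : Fin n → ℝ) (s : ℝ) : {μ | newtonWeight L hL δ μ = s}.Finite := by
  have hfin (l) (hl : l ∈ L) :
      {μ : Fin n →₀ ℕ | l ((fun i => (μ i : ℝ)) + δ) = s}.Finite := by
    refine (Set.finite_Iic (Finsupp.equivFunOnFinite.symm
      fun i ↦ ⌊(s - l δ) / l (Pi.single i 1)⌋₊)).subset fun μ hμ i ↦ ?_
    have hexp : l (fun i => (μ i : ℝ)) = ∑ j, (μ j : ℝ) * l (Pi.single j 1) := by
      have hsingle (j : Fin n) :
          (fun k ↦ if j = k then (1 : ℝ) else 0) = Pi.single j 1 := by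
        ext k
        simp [Pi.single_apply, eq_comm]
      rw [LinearMap.pi_apply_eq_sum_univ l]
      simp_rw [hsingle, smul_eq_mul]
    have hi : (μ i : ℝ) * l (Pi.single i 1) ≤ s - l δ := by
      rw [Set.mem_ofPred_eq, map_add, hexp] at hμ
      rw [← hμ, add_sub_cancel_right]
      exact Finset.single_le_sum (f := fun j ↦ (μ j : ℝ) * l (Pi.single j 1))
        (fun j _ ↦ mul_nonneg (Nat.cast_nonneg _) (hpos l hl j).le) (Finset.mem_univ i)
    exact Nat.le_floor ((le_div_iff₀ (hpos l hl i)).mpr hi)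
  refine (L.finite_toSet.biUnion hfin).subset fun μ hμ ↦ ?_
  obtain ⟨l, hl, h⟩ := Finset.exists_mem_eq_inf' hL fun l => l ((fun i => (μ i : ℝ)) + δ)
  exact Set.mem_biUnion hl (h.symm.trans hμ)

theorem span_setOf_forall_mem_support {σ R : Type*} [CommSemiring R] (A : Set (σ →₀ ℕ)) :
    Submodule.span R {f : MvPolynomial σ R | ∀ μ ∈ f.support, μ ∈ A} = restrictSupport R A :=
  Submodule.span_eq (restrictSupport R A)

/-- A complement of `B ⊔ ker φ` relative to `A` computes the dimension of `φ(A) / φ(B)`. -/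
theorem finrank_map_quotient_comap_map {R M Q : Type*} [Ring R] [AddCommGroup M] [Module R M]
    [AddCommGroup Q] [Module R Q] (φ : M →ₗ[R] Q) (N A B : Submodule R M) (hN : N ≤ A)
    (hspan : A ≤ N ⊔ (B ⊔ LinearMap.ker φ)) (hdisj : Disjoint N (B ⊔ LinearMap.ker φ)) :
    Module.finrank R (↥(A.map φ) ⧸ (B.map φ).comap (A.map φ).subtype) = Module.finrank R N := by
  let T : N →ₗ[R] (↥(A.map φ) ⧸ (B.map φ).comap (A.map φ).subtype) :=
    (Submodule.mkQ _).comp (φ.restrict fun x hx ↦ Submodule.mem_map_of_mem (hN hx))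
  refine (LinearEquiv.finrank_eq (LinearEquiv.ofBijective T ⟨?_, ?_⟩)).symm
  · rw [← LinearMap.ker_eq_bot, LinearMap.ker_eq_bot']
    rintro ⟨x, hx⟩ h
    obtain ⟨b, hb, hbx⟩ : φ x ∈ B.map φ := by
      simpa [T, Submodule.Quotient.mk_eq_zero] using h
    have : x ∈ B ⊔ LinearMap.ker φ := Submodule.mem_sup.mpr
      ⟨b, hb, x - b, by simp [hbx], by abel⟩
    exact Subtype.ext (Submodule.disjoint_def.mp hdisj x hx this)
  · intro q
    obtain ⟨⟨_, a, ha, rfl⟩, rfl⟩ := Submodule.mkQ_surjective _ q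
    obtain ⟨x, hx, y, hy, rfl⟩ := Submodule.mem_sup.mp (hspan ha)
    obtain ⟨b, hb, k, hk, rfl⟩ := Submodule.mem_sup.mp hy
    refine ⟨⟨x, hx⟩, (Submodule.Quotient.eq _).mpr ?_⟩
    refine ⟨-b, neg_mem hb, ?_⟩
    simp [LinearMap.mem_ker.mp hk]

section Standard

variable {n : ℕ} {K : Type} [Field K] (ord : LinearOrder (Fin n →₀ ℕ))
  (J : Ideal (MvPolynomial (Fin n) K))

/-- Standard monomials in a set `W` are independent modulo `J` and monomials below `W`. -/
theorem disjoint_restrictSupport_standard (W V : Set (Fin n →₀ ℕ))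
    (hWV : ∀ μ ∈ W, ∀ ν ∈ V, ord.lt ν μ) :
    Disjoint (restrictSupport K {μ | μ ∉ leadSetI ord J ∧ μ ∈ W})
      (restrictSupport K V ⊔ J.restrictScalars K) := by
  rw [Submodule.disjoint_def]
  intro f hf hfVJ
  by_contra hf0
  obtain ⟨h, hh, g, hg, rfl⟩ := Submodule.mem_sup.mp hfVJ
  set μ := leadMonomial ord (h + g)
  have hμs : μ ∈ (h + g).support := leadMonomial_mem_support ord hf0
  have hμW := hf hμs
  have hhμ {ν : Fin n →₀ ℕ} (hν : ν ∈ h.support) : ord.lt ν μ := hWV μ hμW.2 ν (hh hν)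
  have hhcoeff {ν : Fin n →₀ ℕ} (hν : ord.le μ ν) : coeff ν h = 0 := by
    by_contra hne
    exact @not_le_of_gt _ ord.toPreorder _ _ (hhμ (mem_support_iff.mpr hne)) hν
  have hgcoeff {ν : Fin n →₀ ℕ} (hν : ord.le μ ν) : coeff ν g = coeff ν (h + g) := by
    rw [coeff_add, hhcoeff hν, zero_add]
  have hμg : μ ∈ g.support := by
    rw [mem_support_iff, hgcoeff (ord.le_refl _)]
    exact mem_support_iff.mp hμs
  refine hμW.1 ⟨g, hg, support_nonempty.mp ⟨μ, hμg⟩,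
    (leadMonomial_eq_of_forall_le ord hμg fun ν hν ↦ ?_).symm⟩
  rcases ord.le_total ν μ with hle | hle
  · exact hle
  · rw [mem_support_iff, hgcoeff hle] at hν
    exact le_leadMonomial ord (mem_support_iff.mpr hν)

/-- Standard monomials in a finite set `W` span, modulo `J` and the monomials in `V`,
all polynomials supported on `W ∪ V`. -/
theorem restrictSupport_le_standard_sup (W V : Set (Fin n →₀ ℕ)) (hW : W.Finite)
    (hdown : ∀ μ ∈ W, ∀ ν, ord.lt ν μ → ν ∈ W ∪ V) :
    restrictSupport K (W ∪ V) ≤ restrictSupport K {μ | μ ∉ leadSetI ord J ∧ μ ∈ W} ⊔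
      (restrictSupport K V ⊔ J.restrictScalars K) := by
  set N := restrictSupport K {μ | μ ∉ leadSetI ord J ∧ μ ∈ W} ⊔
      (restrictSupport K V ⊔ J.restrictScalars K)
  have hV {ν : Fin n →₀ ℕ} (hν : ν ∈ V) (c : K) : monomial ν c ∈ N :=
    Submodule.mem_sup_right (Submodule.mem_sup_left
      ((monomial_mem_restrictSupport (R := K)).mpr (Or.inl hν)))
  have hmem : ∀ μ ∈ W, monomial μ (1 : K) ∈ N := by
    by_contra! hbad
    obtain ⟨μ, ⟨hμW, hμN⟩, hmin⟩ := @Set.exists_min_image _ _ ord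
      {μ | μ ∈ W ∧ monomial μ (1 : K) ∉ N} id (hW.subset fun _ h ↦ h.1) hbad
    have hgood {ν : Fin n →₀ ℕ} (hν : ord.lt ν μ) (c : K) : monomial ν c ∈ N := by
      rcases hdown μ hμW ν hν with hνW | hνV
      · have h1 : monomial ν (1 : K) ∈ N := by
          by_contra hνN
          exact @not_le_of_gt _ ord.toPreorder _ _ hν (hmin ν ⟨hνW, hνN⟩)
        simpa [smul_monomial] using N.smul_mem c h1
      · exact hV hνV c
    by_cases hμL : μ ∈ leadSetI ord J
    · obtain ⟨g, hg, hg0, rfl⟩ := hμL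
      have hlm := leadMonomial_mem_support ord hg0
      have hgN : g ∈ N := Submodule.mem_sup_right (Submodule.mem_sup_right hg)
      have hsum := g.as_sum
      rw [← Finset.add_sum_erase _ _ hlm] at hsum
      have htail : ∑ ν ∈ g.support.erase (leadMonomial ord g), monomial ν (coeff ν g) ∈ N :=
        sum_mem fun ν hν ↦ hgood (@lt_of_le_of_ne _ ord.toPartialOrder _ _
          (le_leadMonomial ord (Finset.mem_of_mem_erase hν)) (Finset.ne_of_mem_erase hν)) _
      have hlead : monomial (leadMonomial ord g) (coeff (leadMonomial ord g) g) ∈ N := by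
        rw [eq_sub_of_add_eq hsum.symm]
        exact sub_mem hgN htail
      apply hμN
      simpa [smul_monomial, inv_mul_cancel₀ (mem_support_iff.mp hlm)] using
        N.smul_mem (coeff (leadMonomial ord g) g)⁻¹ hlead
    · exact hμN (Submodule.mem_sup_left
        ((monomial_mem_restrictSupport (R := K)).mpr (Or.inl ⟨hμL, hμW⟩)))
  rw [restrictSupport_eq_span, Submodule.span_le]
  rintro _ ⟨μ, hμ | hμ, rfl⟩
  · exact hmem μ hμ
  · exact hV hμ 1

end Standard

/-- for a normal local Newton ordering, the dimension of the `s`-th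
graded piece of `K[x]/Ī` for the Newton filtration equals the number of monomials
`x^α ∉ L(I)` of Newton weight `s`. -/
theorem graded_piece_dim_eq_count {n : ℕ} {K : Type} [Field K]
    (L : Finset ((Fin n → ℝ) →ₗ[ℝ] ℝ)) (hL : L.Nonempty)
    (hpos : ∀ l ∈ L, ∀ i : Fin n, 0 < l (Pi.single i 1))
    (δ : Fin n → ℚ) (hδ : ∀ i, 0 ≤ δ i)
    (ord₀ ord : LinearOrder (Fin n →₀ ℕ))
    (hsg : ∀ a b c : Fin n →₀ ℕ, ord₀.lt a b → ord₀.lt (a + c) (b + c))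
    (hord : ∀ a b : Fin n →₀ ℕ, ord.lt a b ↔
      (newtonWeight L hL (fun i => (δ i : ℝ)) b <
          newtonWeight L hL (fun i => (δ i : ℝ)) a ∨
        (newtonWeight L hL (fun i => (δ i : ℝ)) a =
            newtonWeight L hL (fun i => (δ i : ℝ)) b ∧ ord₀.lt a b)))
    (hnormal : ∀ (f : MvPolynomial (Fin n) K), f ≠ 0 → ∀ α : Fin n →₀ ℕ,
      ord.lt α 0 → ord.lt (leadMonomial ord (monomial α (1 : K) * f))
        (leadMonomial ord f))
    (hlocal : ∀ i : Fin n, ord.lt (Finsupp.single i 1) 0)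
    (I : Ideal (MvPolynomial (Fin n) K))
    (S : Submonoid (MvPolynomial (Fin n) K))
    (hS : ∀ g : MvPolynomial (Fin n) K,
      g ∈ S ↔ (g ≠ 0 ∧ leadMonomial ord g = 0))
    (Ibar : Ideal (MvPolynomial (Fin n) K))
    (hIbar : Ibar = Ideal.comap
      (algebraMap (MvPolynomial (Fin n) K) (Localization S))
      (Ideal.map (algebraMap (MvPolynomial (Fin n) K) (Localization S)) I))
    (hfd : ∀ s : ℝ, Module.Finite K
      (↥(filtPiece L hL (fun i => (δ i : ℝ)) Ibar s) ⧸
        Submodule.comap (filtPiece L hL (fun i => (δ i : ℝ)) Ibar s).subtype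
          (filtPieceGT L hL (fun i => (δ i : ℝ)) Ibar s)))
    (s : ℝ) :
    Module.finrank K
      (↥(filtPiece L hL (fun i => (δ i : ℝ)) Ibar s) ⧸
        Submodule.comap (filtPiece L hL (fun i => (δ i : ℝ)) Ibar s).subtype
          (filtPieceGT L hL (fun i => (δ i : ℝ)) Ibar s)) =
    Nat.card {μ : Fin n →₀ ℕ //
      μ ∉ leadSetI ord I ∧ newtonWeight L hL (fun i => (δ i : ℝ)) μ = s} := by
  have hmem (f : MvPolynomial (Fin n) K) : f ∈ Ibar ↔ ∃ u ∈ S, u * f ∈ I := by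
    rw [hIbar, Ideal.mem_comap, IsLocalization.algebraMap_mem_map_algebraMap_iff S]
  have hlead : leadSetI ord Ibar = leadSetI ord I := by
    ext μ
    constructor
    · rintro ⟨g, hg, hg0, rfl⟩
      obtain ⟨u, hu, hug⟩ := (hmem g).mp hg
      obtain ⟨hu0, hulm⟩ := (hS u).mp hu
      exact ⟨u * g, hug, mul_ne_zero hu0 hg0,
        (leadMonomial_unit_mul ord hnormal hu0 hulm hg0).symm⟩
    · rintro ⟨g, hg, hg0, rfl⟩
      exact ⟨g, (hmem g).mpr ⟨1, S.one_mem, by rwa [one_mul]⟩, hg0, rfl⟩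
  set w := newtonWeight L hL (fun i => (δ i : ℝ))
  have hunion : {μ | s ≤ w μ} = {μ | w μ = s} ∪ {μ | s < w μ} := by
    ext μ
    exact (le_iff_eq_or_lt (a := s) (b := w μ)).trans (or_congr_left eq_comm)
  have hker : LinearMap.ker (Ideal.Quotient.mkₐ K Ibar).toLinearMap =
      Ibar.restrictScalars K := by
    ext f
    exact Ideal.Quotient.eq_zero_iff_mem
  rw [← hlead]
  have hcard := Module.finrank_eq_nat_card_basis
    (basisRestrictSupport K {μ | μ ∉ leadSetI ord Ibar ∧ μ ∈ {μ | w μ = s}})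
  refine Eq.trans ?_ hcard
  have hA : filtPiece L hL (fun i => (δ i : ℝ)) Ibar s =
      (restrictSupport K {μ | s ≤ w μ}).map (Ideal.Quotient.mkₐ K Ibar).toLinearMap :=
    congrArg _ (span_setOf_forall_mem_support _)
  have hB : filtPieceGT L hL (fun i => (δ i : ℝ)) Ibar s =
      (restrictSupport K {μ | s < w μ}).map (Ideal.Quotient.mkₐ K Ibar).toLinearMap :=
    congrArg _ (span_setOf_forall_mem_support _)
  rw [hA, hB]
  apply finrank_map_quotient_comap_map
  · exact restrictSupport_mono K fun μ hμ ↦ hμ.2.ge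
  · rw [hker, hunion]
    refine restrictSupport_le_standard_sup ord Ibar _ _
      (finite_setOf_newtonWeight_eq L hL hpos _ s) fun μ hμ ν hν ↦ ?_
    rcases (hord ν μ).mp hν with h | h
    · exact Or.inr (lt_of_eq_of_lt (Eq.symm hμ) h)
    · exact Or.inl (h.1.trans hμ)
  · rw [hker]
    exact disjoint_restrictSupport_standard ord Ibar _ _ fun μ hμ ν hν ↦
      (hord ν μ).mpr (Or.inl (lt_of_eq_of_lt hμ hν))
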